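/- Let X be a real normed space and let p be a real number with 0 ≤ p ≤ 1 (equivalently 0 ≤ p/(2−p) ≤ 1). Then for all nonzero x, y ∈ X, α_p[x,y] ≤ ((4 − 3p)/(2 − p)) · β_p[x,y] / max(‖x‖^{p−1}‖y‖^{1−p}, ‖y‖^{p−1}‖x‖^{1−p}). -/

import Mathlib

open Filter

/-- The `p`-angular distance `α_p[x,y] = ‖ ‖x‖^(p-1) • x − ‖y‖^(p-1) • y ‖`. -/
noncomputable def alphaP {X : Type*} [NormedAddCommGroup X] [NormedSpace ℝ X]
    (p : ℝ) (x y : X) : ℝ :=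
  ‖(‖x‖ ^ (p - 1)) • x - (‖y‖ ^ (p - 1)) • y‖

/-- The skew `p`-angular distance `β_p[x,y] = ‖ ‖y‖^(p-1) • x − ‖x‖^(p-1) • y ‖`. -/
noncomputable def betaP {X : Type*} [NormedAddCommGroup X] [NormedSpace ℝ X]
    (p : ℝ) (x y : X) : ℝ :=
  ‖(‖y‖ ^ (p - 1)) • x - (‖x‖ ^ (p - 1)) • y‖

/-- The Maligranda–Rooin constant `MR_p(X)`. -/
noncomputable def MRconst (X : Type*) [NormedAddCommGroup X] [NormedSpace ℝ X]
    (p : ℝ) : ℝ :=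
  sSup { r : ℝ | ∃ x y : X, x ≠ 0 ∧ y ≠ 0 ∧ betaP p x y ≠ 0 ∧
    r = alphaP p x y / betaP p x y }

lemma alphaP_comm {X : Type*} [NormedAddCommGroup X] [NormedSpace ℝ X] (p : ℝ) (x y : X) :
    alphaP p x y = alphaP p y x := norm_sub_rev _ _

lemma betaP_comm {X : Type*} [NormedAddCommGroup X] [NormedSpace ℝ X] (p : ℝ) (x y : X) :
    betaP p x y = betaP p y x := norm_sub_rev _ _

/-- Maligranda's upper bound for the `q`-angular distance, `0 ≤ q ≤ 1`. -/
lemma rpow_norm_mul_alphaP_le {X : Type*} [NormedAddCommGroup X] [NormedSpace ℝ X]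
    {q : ℝ} (hq0 : 0 ≤ q) (hq1 : q ≤ 1) {x y : X} (hy : y ≠ 0) (hxy : ‖y‖ ≤ ‖x‖) :
    ‖x‖ ^ (1 - q) * alphaP q x y ≤ (2 - q) * ‖x - y‖ := by
  have hb : 0 < ‖y‖ := norm_pos_iff.mpr hy
  have ha : 0 < ‖x‖ := hb.trans_le hxy
  set c := ‖x‖ ^ (1 - q) * ‖y‖ ^ (q - 1) with hc
  have hc1 : 1 ≤ c := by
    have h : ‖y‖ ^ (1 - q) ≤ ‖x‖ ^ (1 - q) :=
      Real.rpow_le_rpow hb.le hxy (by linarith)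
    calc (1 : ℝ) = ‖y‖ ^ (1 - q) * ‖y‖ ^ (q - 1) := by
          rw [← Real.rpow_add hb]; simp
      _ ≤ c := by rw [hc]; gcongr
  have hcb : c * ‖y‖ = ‖y‖ ^ q * ‖x‖ ^ (1 - q) := by
    rw [hc, mul_assoc, Real.rpow_sub_one hb.ne', div_mul_cancel₀ _ hb.ne', mul_comm]
  have hag : ‖y‖ ^ q * ‖x‖ ^ (1 - q) ≤ q * ‖y‖ + (1 - q) * ‖x‖ :=
    Real.geom_mean_le_arith_mean2_weighted hq0 (by linarith) hb.le ha.le (by ring)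
  have hdiff : ‖x‖ - ‖y‖ ≤ ‖x - y‖ := norm_sub_norm_le x y
  have hscale : ‖x‖ ^ (1 - q) * alphaP q x y = ‖(x - y) - (c - 1) • y‖ := by
    have h1 : ‖x‖ ^ (1 - q) * ‖x‖ ^ (q - 1) = 1 := by
      rw [← Real.rpow_add ha]; simp
    rw [alphaP, ← norm_smul_of_nonneg (by positivity), smul_sub, smul_smul, smul_smul, h1, ← hc]
    congr 1
    module
  calc ‖x‖ ^ (1 - q) * alphaP q x y ≤ ‖x - y‖ + ‖(c - 1) • y‖ := hscale ▸ norm_sub_le _ _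
    _ = ‖x - y‖ + (c - 1) * ‖y‖ := by rw [norm_smul_of_nonneg (by linarith)]
    _ ≤ (2 - q) * ‖x - y‖ := by nlinarith

lemma norm_rpow_norm_smul {X : Type*} [NormedAddCommGroup X] [NormedSpace ℝ X]
    (r : ℝ) {x : X} (hx : x ≠ 0) : ‖‖x‖ ^ r • x‖ = ‖x‖ ^ (r + 1) := by
  rw [norm_smul_of_nonneg (by positivity), Real.rpow_add_one (norm_ne_zero_iff.mpr hx)]

/-- The `p`-angular distance is the `p / (2 - p)`-angular distance of rescaled vectors. -/
lemma alphaP_eq_alphaP_rpow_smul {X : Type*} [NormedAddCommGroup X] [NormedSpace ℝ X]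
    {p : ℝ} (hp : p ≠ 2) {x y : X} (hx : x ≠ 0) (hy : y ≠ 0) :
    alphaP p x y =
      alphaP (p / (2 - p)) (‖x‖ ^ (1 - p) • x) (‖y‖ ^ (1 - p) • y) := by
  have key {z : X} (hz : z ≠ 0) :
      ‖‖z‖ ^ (1 - p) • z‖ ^ (p / (2 - p) - 1) * ‖z‖ ^ (1 - p) = ‖z‖ ^ (p - 1) := by
    have h2 : 2 - p ≠ 0 := sub_ne_zero.mpr hp.symm
    rw [norm_rpow_norm_smul _ hz, ← Real.rpow_mul (norm_nonneg z),
      ← Real.rpow_add (norm_pos_iff.mpr hz)]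
    congr 1
    field_simp
    ring
  simp only [alphaP, smul_smul, key hx, key hy]

/-- The skew `p`-angular distance is a multiple of the distance of rescaled vectors. -/
lemma rpow_mul_betaP {X : Type*} [NormedAddCommGroup X] [NormedSpace ℝ X]
    (p : ℝ) {x y : X} (hx : x ≠ 0) (hy : y ≠ 0) :
    ‖x‖ ^ (1 - p) * ‖y‖ ^ (1 - p) * betaP p x y =
      ‖‖x‖ ^ (1 - p) • x - ‖y‖ ^ (1 - p) • y‖ := by
  have key {z : X} (hz : z ≠ 0) : ‖z‖ ^ (1 - p) * ‖z‖ ^ (p - 1) = 1 := by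
    rw [← Real.rpow_add (norm_pos_iff.mpr hz)]; simp
  rw [betaP, ← norm_smul_of_nonneg (by positivity), smul_sub, smul_smul, smul_smul,
    mul_assoc, key hy, mul_right_comm, key hx, mul_one, one_mul]

lemma alphaP_le_of_norm_le {X : Type*} [NormedAddCommGroup X] [NormedSpace ℝ X]
    {p : ℝ} (hp0 : 0 ≤ p) (hp1 : p ≤ 1) {x y : X} (hy : y ≠ 0) (hxy : ‖y‖ ≤ ‖x‖) :
    alphaP p x y ≤ ((4 - 3 * p) / (2 - p)) * betaP p x y /
      (max (‖x‖ ^ (p - 1) * ‖y‖ ^ (1 - p)) (‖y‖ ^ (p - 1) * ‖x‖ ^ (1 - p))) := by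
  have hb : 0 < ‖y‖ := norm_pos_iff.mpr hy
  have ha : 0 < ‖x‖ := hb.trans_le hxy
  have hx : x ≠ 0 := norm_pos_iff.mp ha
  have h2 : 0 < 2 - p := by linarith
  have hmax : max (‖x‖ ^ (p - 1) * ‖y‖ ^ (1 - p)) (‖y‖ ^ (p - 1) * ‖x‖ ^ (1 - p)) =
      ‖y‖ ^ (p - 1) * ‖x‖ ^ (1 - p) :=
    max_eq_right (mul_le_mul (Real.rpow_le_rpow_of_nonpos hb hxy (by linarith))
      (Real.rpow_le_rpow hb.le hxy (by linarith)) (by positivity) (by positivity))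
  have hnorm : ‖‖y‖ ^ (1 - p) • y‖ ≤ ‖‖x‖ ^ (1 - p) • x‖ := by
    rw [norm_rpow_norm_smul _ hx, norm_rpow_norm_smul _ hy]
    exact Real.rpow_le_rpow hb.le hxy (by linarith)
  have h := rpow_norm_mul_alphaP_le (q := p / (2 - p)) (by positivity)
    ((div_le_one h2).mpr (by linarith)) (smul_ne_zero (by positivity) hy) hnorm
  rw [← alphaP_eq_alphaP_rpow_smul (by linarith) hx hy, ← rpow_mul_betaP p hx hy,
    norm_rpow_norm_smul _ hx, ← Real.rpow_mul ha.le,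
    show (1 - p + 1) * (1 - p / (2 - p)) = (1 - p) + (1 - p) by field_simp; ring,
    show 2 - p / (2 - p) = (4 - 3 * p) / (2 - p) by field_simp; ring,
    Real.rpow_add ha] at h
  have hinv : ‖y‖ ^ (p - 1) = (‖y‖ ^ (1 - p))⁻¹ := by
    rw [← Real.rpow_neg hb.le, neg_sub]
  have hA : 0 < ‖x‖ ^ (1 - p) := by positivity
  have hB : 0 < ‖y‖ ^ (1 - p) := by positivity
  rw [hmax, le_div_iff₀ (by positivity), hinv, inv_mul_eq_div, mul_div_assoc', div_le_iff₀ hB]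
  refine le_of_mul_le_mul_left ?_ hA
  linarith

theorem stmt4 (X : Type*) [NormedAddCommGroup X] [NormedSpace ℝ X]
    (p : ℝ) (hp0 : 0 ≤ p) (hp1 : p ≤ 1)
    (x y : X) (hx : x ≠ 0) (hy : y ≠ 0) :
    alphaP p x y ≤ ((4 - 3 * p) / (2 - p)) * betaP p x y /
      (max (‖x‖ ^ (p - 1) * ‖y‖ ^ (1 - p)) (‖y‖ ^ (p - 1) * ‖x‖ ^ (1 - p))) := by
  rcases le_total ‖y‖ ‖x‖ with h | h
  · exact alphaP_le_of_norm_le hp0 hp1 hy h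
  · rw [alphaP_comm, betaP_comm, max_comm]
    exact alphaP_le_of_norm_le hp0 hp1 hx h
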